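/- arXiv:2208.03788 — 2 statements merged into one kernel-verified Lean document; each statement's English description precedes it below -/
import Mathlib

section
/- Let m ≥ 3 be an odd natural number and n ≥ 3 an even natural number. Then there exists a bijection σ : V → [mn], where V = {(i,j) : i ∈ [m], j ∈ [n]}, such that Σ_{t=1}^{mn−1} d(σ⁻¹(t), σ⁻¹(t+1)) = mn(m+n)/2 − n/2 − 1. -/
/-- The Manhattan distance between two vertices of the grid graph `P_m × P_n`. -/
def gridDist {m n : ℕ} (p q : Fin m × Fin n) : ℕ :=
  Nat.dist p.1 q.1 + Nat.dist p.2 q.2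

/-- The length of the walk induced by a labeling (bijection) `σ` of the vertices of
`P_m × P_n` by `{1, …, mn}`: the sum of Manhattan distances between consecutively
labeled vertices. -/
def walkLen (m n : ℕ) (σ : Fin m × Fin n ≃ Fin (m * n)) : ℕ :=
  ∑ t : Fin (m * n - 1),
    gridDist (σ.symm (t.castLE (by omega))) (σ.symm ⟨t.val + 1, by omega⟩)

/-- `M(P_m × P_n)`: the maximal length of a walk induced by a labeling of `P_m × P_n`. -/
noncomputable def maxWalk (m n : ℕ) : ℕ := sSup (Set.range (walkLen m n))

/-- Adding the values at the two ends of each step counts every value twice, up to the endpoints. -/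
theorem sum_consecutive_add_ends {N : ℕ} (hN : 0 < N) (F : Fin N → ℕ) :
    (∑ t : Fin (N - 1), (F (t.castLE (by omega)) + F ⟨t.val + 1, by omega⟩))
      + F ⟨0, hN⟩ + F ⟨N - 1, by omega⟩ = 2 * ∑ t, F t := by
  obtain ⟨N, rfl⟩ := Nat.exists_eq_add_one_of_ne_zero hN.ne'
  have h1 := Fin.sum_univ_castSucc F
  have h2 := Fin.sum_univ_succ F
  rw [Finset.sum_add_distrib]
  change (∑ t : Fin N, F t.castSucc) + (∑ t : Fin N, F t.succ) + F 0 + F (Fin.last N) =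
    2 * ∑ t : Fin (N + 1), F t
  omega

/-- Twice the distance from position `i` to the centre of a path on `N` vertices. -/
def centralDist (N i : ℕ) : ℕ := Nat.dist (2 * i + 1) N

theorem sum_centralDist_add_two (N : ℕ) :
    ∑ i ∈ Finset.range (N + 2), centralDist (N + 2) i =
      ∑ i ∈ Finset.range N, centralDist N i + 2 * (N + 1) := by
  rw [Finset.sum_range_succ, Finset.sum_range_succ']
  have h : ∀ i, centralDist (N + 2) (i + 1) = centralDist N i := by
    intro i; simp only [centralDist, Nat.dist]; omega
  simp only [h]
  simp only [centralDist, Nat.dist]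
  omega

theorem sum_centralDist_even (h : ℕ) :
    ∑ i ∈ Finset.range (2 * h), centralDist (2 * h) i = 2 * h ^ 2 := by
  induction h with
  | zero => simp
  | succ h ih => rw [Nat.mul_succ, sum_centralDist_add_two, ih]; ring

theorem sum_centralDist_odd (k : ℕ) :
    ∑ i ∈ Finset.range (2 * k + 1), centralDist (2 * k + 1) i = 2 * k * (k + 1) := by
  induction k with
  | zero => simp [centralDist, Nat.dist]
  | succ k ih =>
    rw [show 2 * (k + 1) + 1 = 2 * k + 1 + 2 by ring, sum_centralDist_add_two, ih]; ring

/-- Twice the distance from a vertex to the centre of the grid. -/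
def gridCentralDist {m n : ℕ} (p : Fin m × Fin n) : ℕ :=
  centralDist m p.1 + centralDist n p.2

theorem sum_gridCentralDist (m n : ℕ) :
    ∑ p : Fin m × Fin n, gridCentralDist p =
      n * ∑ i ∈ Finset.range m, centralDist m i + m * ∑ j ∈ Finset.range n, centralDist n j := by
  simp only [gridCentralDist, Fintype.sum_prod_type, Finset.sum_add_distrib, Finset.sum_const,
    Finset.card_univ, Fintype.card_fin, smul_eq_mul, ← Finset.mul_sum, Finset.sum_range]

/-- The position, counted from `0`, of the vertex `(i, j)` of the `(2k+1) × 2h` grid in a walk all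
of whose steps cross both medians. It alternates between two opposite quadrants, then between the
two halves of the middle row, then between the other two quadrants; it starts and ends at the two
central vertices. -/
def crossingLabel (k h i j : ℕ) : ℕ :=
  if i < k then
    if j < h then 2 * (k * h) + 2 * h + 2 * (i * h + j)
    else 1 + 2 * (i * h + (j - h))
  else if i = k then
    if j < h then if j = h - 1 then 0 else 2 * (k * h) + 2 * (h - 1 - j)
    else if j = h then 4 * (k * h) + 2 * h - 1 else 2 * (k * h) + 2 * (j - h) - 1
  else
    if j < h then 2 + 2 * ((i - k - 1) * h + j)
    else 2 * (k * h) + 2 * h - 1 + 2 * ((i - k - 1) * h + (j - h))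

theorem mul_add_lt_mul {k h i j : ℕ} (hi : i < k) (hj : j < h) : i * h + j < k * h := by
  nlinarith [Nat.mul_le_mul_right h (Nat.succ_le_of_lt hi)]

theorem eq_and_eq_of_mul_add_eq {h i i' j j' : ℕ} (hj : j < h) (hj' : j' < h)
    (e : i * h + j = i' * h + j') : i = i' ∧ j = j' := by
  have hi : i = i' := by
    rcases lt_trichotomy i i' with hlt | heq | hlt
    · have := mul_add_lt_mul hlt hj; omega
    · exact heq
    · have := mul_add_lt_mul hlt hj'; omega
  subst hi
  exact ⟨rfl, by omega⟩

theorem crossingLabel_lt {k h i j : ℕ} (hi : i < 2 * k + 1) (hj : j < 2 * h) :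
    crossingLabel k h i j < (2 * k + 1) * (2 * h) := by
  have e : (2 * k + 1) * (2 * h) = 4 * (k * h) + 2 * h := by ring
  have h1 : i < k → j < h → i * h + j < k * h := mul_add_lt_mul
  have h2 : i < k → j - h < h → i * h + (j - h) < k * h := mul_add_lt_mul
  have h3 : i - k - 1 < k → j < h → (i - k - 1) * h + j < k * h := mul_add_lt_mul
  have h4 : i - k - 1 < k → j - h < h → (i - k - 1) * h + (j - h) < k * h := mul_add_lt_mul
  rw [e]
  unfold crossingLabel
  split_ifs <;> omega

theorem crossingLabel_injective {k h i j i' j' : ℕ} (hi : i < 2 * k + 1) (hj : j < 2 * h)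
    (hi' : i' < 2 * k + 1) (hj' : j' < 2 * h)
    (e : crossingLabel k h i j = crossingLabel k h i' j') : i = i' ∧ j = j' := by
  have h1 : i < k → j < h → i * h + j < k * h := mul_add_lt_mul
  have h2 : i < k → j - h < h → i * h + (j - h) < k * h := mul_add_lt_mul
  have h3 : i - k - 1 < k → j < h → (i - k - 1) * h + j < k * h := mul_add_lt_mul
  have h4 : i - k - 1 < k → j - h < h → (i - k - 1) * h + (j - h) < k * h := mul_add_lt_mul
  have h1' : i' < k → j' < h → i' * h + j' < k * h := mul_add_lt_mul
  have h2' : i' < k → j' - h < h → i' * h + (j' - h) < k * h := mul_add_lt_mul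
  have h3' : i' - k - 1 < k → j' < h → (i' - k - 1) * h + j' < k * h := mul_add_lt_mul
  have h4' : i' - k - 1 < k → j' - h < h → (i' - k - 1) * h + (j' - h) < k * h := mul_add_lt_mul
  have hreg : (i < k ↔ i' < k) ∧ (i = k ↔ i' = k) ∧ (j < h ↔ j' < h) := by
    unfold crossingLabel at e
    split_ifs at e <;> omega
  clear h1 h2 h3 h4 h1' h2' h3' h4'
  obtain ⟨r1, r2, r3⟩ := hreg
  simp only [crossingLabel, ← r1, ← r2, ← r3] at e
  rcases lt_trichotomy i k with hik | hik | hik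
  · simp only [if_pos hik] at e
    by_cases hjh : j < h
    · simp only [if_pos hjh] at e
      exact eq_and_eq_of_mul_add_eq hjh (r3.mp hjh) (by omega)
    · simp only [if_neg hjh] at e
      have := eq_and_eq_of_mul_add_eq (h := h) (i := i) (i' := i') (j := j - h) (j' := j' - h)
        (by omega) (by omega) (by omega)
      omega
  · refine ⟨by omega, ?_⟩
    simp only [if_neg hik.not_lt, if_pos hik] at e
    split_ifs at e <;> omega
  · simp only [if_neg hik.not_gt, if_neg hik.ne'] at e
    by_cases hjh : j < h
    · simp only [if_pos hjh] at e
      have := eq_and_eq_of_mul_add_eq (h := h) (i := i - k - 1) (i' := i' - k - 1) hjh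
        (r3.mp hjh) (by omega)
      omega
    · simp only [if_neg hjh] at e
      have := eq_and_eq_of_mul_add_eq (h := h) (i := i - k - 1) (i' := i' - k - 1)
        (j := j - h) (j' := j' - h) (by omega) (by omega) (by omega)
      omega

theorem two_mul_dist_of_crossingLabel_succ {k h i j i' j' : ℕ}
    (hi : i < 2 * k + 1) (hj : j < 2 * h) (hi' : i' < 2 * k + 1) (hj' : j' < 2 * h) (hh : 2 ≤ h)
    (e : crossingLabel k h i' j' = crossingLabel k h i j + 1) :
    2 * (Nat.dist i i' + Nat.dist j j') =
      centralDist (2 * k + 1) i + centralDist (2 * h) j +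
        (centralDist (2 * k + 1) i' + centralDist (2 * h) j') := by
  have h1 : i < k → j < h → i * h + j < k * h := mul_add_lt_mul
  have h2 : i < k → j - h < h → i * h + (j - h) < k * h := mul_add_lt_mul
  have h3 : i - k - 1 < k → j < h → (i - k - 1) * h + j < k * h := mul_add_lt_mul
  have h4 : i - k - 1 < k → j - h < h → (i - k - 1) * h + (j - h) < k * h := mul_add_lt_mul
  have h1' : i' < k → j' < h → i' * h + j' < k * h := mul_add_lt_mul
  have h2' : i' < k → j' - h < h → i' * h + (j' - h) < k * h := mul_add_lt_mul
  have h3' : i' - k - 1 < k → j' < h → (i' - k - 1) * h + j' < k * h := mul_add_lt_mul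
  have h4' : i' - k - 1 < k → j' - h < h → (i' - k - 1) * h + (j' - h) < k * h := mul_add_lt_mul
  have hmed : ((i ≤ k ∧ k ≤ i') ∨ (i' ≤ k ∧ k ≤ i)) ∧ ((j < h ∧ h ≤ j') ∨ (j' < h ∧ h ≤ j)) := by
    unfold crossingLabel at e
    split_ifs at e <;> omega
  simp only [centralDist, Nat.dist]
  omega

/-- The labeling of the grid given by `crossingLabel`. -/
noncomputable def crossingEquiv (k h : ℕ) :
    Fin (2 * k + 1) × Fin (2 * h) ≃ Fin ((2 * k + 1) * (2 * h)) :=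
  Equiv.ofBijective
    (fun p => ⟨crossingLabel k h p.1 p.2, crossingLabel_lt p.1.isLt p.2.isLt⟩) <| by
    rw [Fintype.bijective_iff_injective_and_card]
    refine ⟨fun p q e => ?_, by simp⟩
    obtain ⟨h1, h2⟩ := crossingLabel_injective p.1.isLt p.2.isLt q.1.isLt q.2.isLt
      (Fin.mk.inj_iff.mp e)
    exact Prod.ext (Fin.ext h1) (Fin.ext h2)

theorem crossingEquiv_val (k h : ℕ) (p : Fin (2 * k + 1) × Fin (2 * h)) :
    (crossingEquiv k h p : ℕ) = crossingLabel k h p.1 p.2 := rfl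

theorem two_mul_gridDist_crossingEquiv_symm {k h : ℕ} (hh : 2 ≤ h)
    {s t : Fin ((2 * k + 1) * (2 * h))} (hst : (t : ℕ) = s + 1) :
    2 * gridDist ((crossingEquiv k h).symm s) ((crossingEquiv k h).symm t) =
      gridCentralDist ((crossingEquiv k h).symm s) +
        gridCentralDist ((crossingEquiv k h).symm t) := by
  refine two_mul_dist_of_crossingLabel_succ (Fin.isLt _) (Fin.isLt _) (Fin.isLt _) (Fin.isLt _)
    hh ?_
  rw [← crossingEquiv_val, ← crossingEquiv_val, Equiv.apply_symm_apply, Equiv.apply_symm_apply, hst]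

theorem walkLen_crossingEquiv {k h : ℕ} (hh : 2 ≤ h) :
    walkLen (2 * k + 1) (2 * h) (crossingEquiv k h) + 1 =
      4 * h * k * (k + 1) + (2 * k + 1) * (2 * h ^ 2) := by
  have hN : 0 < (2 * k + 1) * (2 * h) := by positivity
  have key := sum_consecutive_add_ends hN fun t => gridCentralDist ((crossingEquiv k h).symm t)
  have hstep : ∀ t : Fin ((2 * k + 1) * (2 * h) - 1), _ := fun t =>
    two_mul_gridDist_crossingEquiv_symm (k := k) hh (s := t.castLE (by omega))
      (t := ⟨t.val + 1, by omega⟩) rfl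
  simp only [← hstep, ← Finset.mul_sum] at key
  have hsum := Equiv.sum_comp (crossingEquiv k h).symm gridCentralDist
  rw [hsum, sum_gridCentralDist, sum_centralDist_even, sum_centralDist_odd] at key
  have first : (crossingEquiv k h).symm ⟨0, hN⟩ = (⟨k, by omega⟩, ⟨h - 1, by omega⟩) := by
    rw [Equiv.symm_apply_eq]
    apply Fin.ext
    rw [crossingEquiv_val]
    simp only [crossingLabel]
    split_ifs <;> omega
  have last : (crossingEquiv k h).symm ⟨(2 * k + 1) * (2 * h) - 1, by omega⟩ =
      (⟨k, by omega⟩, ⟨h, by omega⟩) := by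
    have e : (2 * k + 1) * (2 * h) = 4 * (k * h) + 2 * h := by ring
    rw [Equiv.symm_apply_eq]
    apply Fin.ext
    rw [crossingEquiv_val]
    simp only [crossingLabel, e]
    split_ifs <;> omega
  have central : ∀ j, j = h - 1 ∨ j = h →
      centralDist (2 * k + 1) k + centralDist (2 * h) j = 1 := by
    intro j hj
    simp only [centralDist, Nat.dist]
    omega
  rw [first, last] at key
  simp only [gridCentralDist] at key
  rw [central _ (Or.inl rfl), central _ (Or.inr rfl)] at key
  unfold walkLen
  linarith

theorem exists_walk_odd_even (m n : ℕ) (hm : 3 ≤ m) (hn : 3 ≤ n)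
    (hmo : Odd m) (hne : Even n) :
    ∃ σ : Fin m × Fin n ≃ Fin (m * n),
      walkLen m n σ = m * n * (m + n) / 2 - n / 2 - 1 := by
  obtain ⟨k, rfl⟩ := hmo
  obtain ⟨h, rfl⟩ := even_iff_exists_two_mul.mp hne
  refine ⟨crossingEquiv k h, ?_⟩
  have hw := walkLen_crossingEquiv (k := k) (h := h) (by omega)
  have e : (2 * k + 1) * (2 * h) * (2 * k + 1 + 2 * h) =
      2 * (4 * h * k * (k + 1) + (2 * k + 1) * (2 * h ^ 2) + h) := by ring
  rw [e]
  omega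
end

section
/- Let n ≥ 3 be an odd natural number. Then M(P_n × P_n) ∈ {n³ − n − 1, n³ − n}; that is, McNeil's conjectured value n³ − n − 1 for M(P_n²) is correct up to an additive constant of 1. -/
open Finset

/-- The distance of a vertex of `P_{2k+1} × P_{2k+1}` to the central vertex. -/
def centerDist {k : ℕ} (p : Fin (2 * k + 1) × Fin (2 * k + 1)) : ℕ :=
  Nat.dist p.1 k + Nat.dist p.2 k

theorem gridDist_le_centerDist_add {k : ℕ} (p q : Fin (2 * k + 1) × Fin (2 * k + 1)) :
    gridDist p q ≤ centerDist p + centerDist q := by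
  simp only [gridDist, centerDist, Nat.dist]
  omega

theorem sum_range_dist_center (k : ℕ) :
    ∑ i ∈ range (2 * k + 1), Nat.dist i k = k * (k + 1) := by
  induction k with
  | zero => simp
  | succ k ih =>
    rw [show 2 * (k + 1) + 1 = (2 * k + 1) + 1 + 1 by ring, sum_range_succ, sum_range_succ']
    simp only [Nat.dist_succ_succ, ih]
    simp only [Nat.dist]
    rw [show 2 * k + 1 - k + (k - (2 * k + 1)) = k + 1 by omega,
      show 0 - (k + 1) + (k + 1 - 0) = k + 1 by omega]
    ring

theorem two_mul_sum_centerDist (k : ℕ) :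
    2 * ∑ p : Fin (2 * k + 1) × Fin (2 * k + 1), centerDist p =
      (2 * k + 1) ^ 3 - (2 * k + 1) := by
  have h : ∑ i : Fin (2 * k + 1), Nat.dist i k = k * (k + 1) := by
    rw [Fin.sum_univ_eq_sum_range (fun i => Nat.dist i k), sum_range_dist_center]
  simp only [centerDist, sum_add_distrib, Fintype.sum_prod_type, h, sum_const, card_univ,
    Fintype.card_fin, smul_eq_mul, ← mul_sum]
  refine (Nat.sub_eq_of_eq_add ?_).symm
  ring

theorem sum_consecutive_add {N : ℕ} (hN : 0 < N) (g : Fin N → ℕ) :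
    ∑ t : Fin (N - 1), (g (t.castLE (by omega)) + g ⟨t.val + 1, by omega⟩)
      + (g ⟨0, hN⟩ + g ⟨N - 1, by omega⟩) = 2 * ∑ i, g i := by
  obtain ⟨M, rfl⟩ : ∃ M, N = M + 1 := ⟨N - 1, by omega⟩
  have h₁ := Fin.sum_univ_castSucc g
  have h₂ := Fin.sum_univ_succ g
  rw [sum_add_distrib]
  change (∑ t : Fin M, g t.castSucc + ∑ t : Fin M, g t.succ) + (g 0 + g (Fin.last M)) = _
  omega

theorem sum_consecutive_centerDist_add {k N : ℕ} (hN : 0 < N)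
    (e : Fin N ≃ Fin (2 * k + 1) × Fin (2 * k + 1)) :
    ∑ t : Fin (N - 1),
        (centerDist (e (t.castLE (by omega))) + centerDist (e ⟨t.val + 1, by omega⟩))
      + (centerDist (e ⟨0, hN⟩) + centerDist (e ⟨N - 1, by omega⟩)) =
      (2 * k + 1) ^ 3 - (2 * k + 1) := by
  rw [sum_consecutive_add hN (fun i => centerDist (e i)), e.sum_comp, two_mul_sum_centerDist]

theorem walkLen_le (k : ℕ)
    (σ : Fin (2 * k + 1) × Fin (2 * k + 1) ≃ Fin ((2 * k + 1) * (2 * k + 1))) :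
    walkLen (2 * k + 1) (2 * k + 1) σ ≤ (2 * k + 1) ^ 3 - (2 * k + 1) := by
  rw [← sum_consecutive_centerDist_add (by positivity) σ.symm]
  exact (sum_le_sum fun t _ => gridDist_le_centerDist_add _ _).trans (Nat.le_add_right _ _)

theorem isChain_cons_flatMap_pair {α : Type*} {R : α → α → Prop} (f : α → α) {b : α}
    {l : List α} (hl : (b :: l).IsChain R) (S : List α) (a : α) (hab : R a b)
    (ha : ∀ p ∈ S, R a p) (hf : ∀ p ∈ S, R p (f p)) (hfb : ∀ p ∈ S, R (f p) b)
    (hff : ∀ p ∈ S, ∀ q ∈ S, R (f p) q) :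
    (a :: (S.flatMap (fun p => [p, f p]) ++ b :: l)).IsChain R := by
  induction S generalizing a with
  | nil => simpa [hab] using hl
  | cons p S ih =>
    simp only [List.mem_cons, forall_eq_or_imp] at ha hf hfb hff
    simp only [List.flatMap_cons, List.cons_append, List.nil_append, List.isChain_cons_cons]
    exact ⟨ha.1, hf.1, ih (f p) hfb.1 hff.1.2 hf.2 hfb.2 fun q hq => (hff.2 q hq).2⟩

/-- A Hamiltonian path from the centre to one of its neighbours, every step of which crosses
both central axes (in the weak sense). -/
theorem exists_centerCrossing_path (k : ℕ) (hk : 1 ≤ k) :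
    ∃ L : List (Fin (2 * k + 1) × Fin (2 * k + 1)),
      L.IsChain (fun p q => gridDist p q = centerDist p + centerDist q) ∧
      L.length = (2 * k + 1) * (2 * k + 1) ∧ (∀ p, p ∈ L) ∧
      (∀ p ∈ L.head?, centerDist p = 0) ∧ ∀ p ∈ L.getLast?, centerDist p = 1 := by
  let c : Fin (2 * k + 1) := ⟨k, by omega⟩
  let u : Fin (2 * k + 1) := ⟨k + 1, by omega⟩
  let d : Fin (2 * k + 1) := ⟨k - 1, by omega⟩
  let top : Fin (2 * k + 1) := ⟨2 * k, by omega⟩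
  let bot : Fin (2 * k + 1) := ⟨0, by omega⟩
  let f : Fin (2 * k + 1) × Fin (2 * k + 1) → Fin (2 * k + 1) × Fin (2 * k + 1) :=
    fun p => (p.1.rev, p.2.rev)
  let Q₁ := (Ioi c ×ˢ Ioi c).toList
  let Q₂ := (Iio c ×ˢ Ioi c).toList
  let A := (Ioo c top ×ˢ {c}).toList ++ (({c} : Finset _) ×ˢ Ioi u).toList
  have hQ₁ : ∀ p ∈ Q₁, k < p.1.val ∧ k < p.2.val := by
    intro p hp
    simpa [Q₁, Fin.lt_def, c] using hp
  have hQ₂ : ∀ p ∈ Q₂, p.1.val < k ∧ k < p.2.val := by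
    intro p hp
    simpa [Q₂, Fin.lt_def, c] using hp
  have hA : ∀ p ∈ A, (k < p.1.val ∧ p.2.val = k) ∨ (p.1.val = k ∧ k < p.2.val) := by
    intro p hp
    simp only [A, List.mem_append, mem_toList, mem_product, mem_Ioo, mem_Ioi, mem_singleton,
      Fin.lt_def, Fin.ext_iff, c, u, top] at hp
    omega
  refine ⟨(c, c) :: (Q₁.flatMap (fun p => [p, f p]) ++ (top, c) ::
    (Q₂.flatMap (fun p => [p, f p]) ++ (bot, c) ::
      (A.flatMap (fun p => [p, f p]) ++ (c, u) :: [(c, d)]))), ?_, ?_, ?_, ?_, ?_⟩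
  · refine isChain_cons_flatMap_pair f (isChain_cons_flatMap_pair f
      (isChain_cons_flatMap_pair f ?_ A _ ?_ ?_ ?_ ?_ ?_) Q₂ _ ?_ ?_ ?_ ?_ ?_)
      Q₁ _ ?_ ?_ ?_ ?_ ?_
    · simp [gridDist, centerDist, Nat.dist, c, u, d]
      omega
    all_goals
      intros
      simp only [gridDist, centerDist, Nat.dist, c, u, top, bot, f, Fin.val_rev]
      grind
  · simp [Q₁, Q₂, A, c, u, top, List.length_flatMap]
    obtain ⟨j, rfl⟩ : ∃ j, k = j + 1 := ⟨k - 1, by omega⟩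
    rw [show 2 * (j + 1) - (j + 1) = j + 1 by omega, show j + 1 - 1 = j by omega,
      show 2 * (j + 1) - (j + 1 + 1) = j by omega]
    ring
  · rintro ⟨⟨x, hx⟩, ⟨y, hy⟩⟩
    simp [Q₁, Q₂, A, c, u, d, f, top, bot, Fin.lt_def, Fin.ext_iff]
    by_contra h
    simp only [not_or, not_exists] at h
    obtain ⟨h₀, h₁, h₂, h₃, h₄, h₅, h₆, h₇, h₈⟩ := h
    have hx' : 2 * k - x < 2 * k + 1 := by omega
    have hy' : 2 * k - y < 2 * k + 1 := by omega
    clear hA hQ₁ hQ₂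
    rcases lt_trichotomy x k with hxk | hxk | hxk <;>
      rcases lt_trichotomy y k with hyk | hyk | hyk
    · exact h₁ ⟨_, hx'⟩ ⟨_, hy'⟩ (by dsimp only; omega)
    · by_cases hx₀ : x = 0
      · exact h₄ ⟨hx₀, hyk⟩
      · exact h₅ ⟨_, hx'⟩ (by dsimp only; omega)
    · exact h₃ ⟨x, hx⟩ ⟨y, hy⟩ (by dsimp only; omega)
    · by_cases hyd : y = k - 1
      · exact h₈ ⟨hxk, hyd⟩
      · exact h₆ ⟨_, hy'⟩ (by dsimp only; omega)
    · exact h₀ ⟨hxk, hyk⟩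
    · by_cases hyu : y = k + 1
      · exact h₇ ⟨hxk, hyu⟩
      · exact h₆ ⟨y, hy⟩ (by dsimp only; omega)
    · exact h₃ ⟨_, hx'⟩ ⟨_, hy'⟩ (by dsimp only; omega)
    · by_cases hxt : x = 2 * k
      · exact h₂ ⟨hxt, hyk⟩
      · exact h₅ ⟨x, hx⟩ (by dsimp only; omega)
    · exact h₁ ⟨x, hx⟩ ⟨y, hy⟩ (by dsimp only; omega)
  · simp [centerDist, c]
  · simp [centerDist, Nat.dist, c, d, List.getLast?_cons, List.getLast?_append]
    omega

theorem exists_walkLen_eq (k : ℕ) (hk : 1 ≤ k) :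
    ∃ σ, walkLen (2 * k + 1) (2 * k + 1) σ = (2 * k + 1) ^ 3 - (2 * k + 1) - 1 := by
  obtain ⟨L, hchain, hlen, hmem, hhead, hlast⟩ := exists_centerCrossing_path k hk
  have hN : 0 < (2 * k + 1) * (2 * k + 1) := by positivity
  let g : Fin ((2 * k + 1) * (2 * k + 1)) → Fin (2 * k + 1) × Fin (2 * k + 1) :=
    fun i => L[i.val]'(by omega)
  have hg : g.Bijective := by
    rw [Fintype.bijective_iff_surjective_and_card]
    refine ⟨fun p => ?_, by simp⟩
    obtain ⟨i, hi, rfl⟩ := List.mem_iff_getElem.1 (hmem p)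
    exact ⟨⟨i, by omega⟩, rfl⟩
  let e := Equiv.ofBijective g hg
  refine ⟨e.symm, ?_⟩
  have hsum := sum_consecutive_centerDist_add hN e
  have h₀ : centerDist (e ⟨0, hN⟩) = 0 := by
    refine hhead _ ?_
    rw [List.head?_eq_getElem?, Option.mem_def, List.getElem?_eq_getElem (by omega)]
    rfl
  have h₁ : centerDist (e ⟨(2 * k + 1) * (2 * k + 1) - 1, by omega⟩) = 1 := by
    refine hlast _ ?_
    rw [List.getLast?_eq_getElem?, Option.mem_def, List.getElem?_eq_getElem (by omega)]
    simp only [hlen]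
    rfl
  rw [← hsum, h₀, h₁, zero_add, Nat.add_sub_cancel]
  exact sum_congr rfl fun t _ => List.isChain_iff_getElem.1 hchain t (by omega)

theorem maxWalk_square_odd (n : ℕ) (hn : 3 ≤ n) (hno : Odd n) :
    maxWalk n n ∈ ({n ^ 3 - n - 1, n ^ 3 - n} : Set ℕ) := by
  obtain ⟨k, rfl⟩ := hno
  obtain ⟨σ, hσ⟩ := exists_walkLen_eq k (by omega)
  have hbdd : BddAbove (Set.range (walkLen (2 * k + 1) (2 * k + 1))) :=
    ⟨_, Set.forall_mem_range.2 (walkLen_le k)⟩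
  have hle : maxWalk (2 * k + 1) (2 * k + 1) ≤ (2 * k + 1) ^ 3 - (2 * k + 1) :=
    csSup_le ⟨_, σ, rfl⟩ (Set.forall_mem_range.2 (walkLen_le k))
  have hge : walkLen _ _ σ ≤ maxWalk (2 * k + 1) (2 * k + 1) := le_csSup hbdd ⟨σ, rfl⟩
  rw [Set.mem_insert_iff, Set.mem_singleton_iff]
  omega
end
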